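/- Let α ∈ [0,1] and β = √(1−α²). The set of nonconstant C² solutions m : ℝ → S² of the expander profile equation α m″ + α|m′|² m + β (m × m′)′ + (x/2) m′ = 0 is exactly { R ∘ m_{c,α} : c > 0, R ∈ SO(3) }, where SO(3) is the group of rotations of ℝ³ preserving orientation. -/

import Mathlib

noncomputable section

open Real MeasureTheory Filter Topology

/-- `E3` is `ℝ³` with the Euclidean norm. -/
abbrev E3 : Type := EuclideanSpace ℝ (Fin 3)

def toE3 (v : Fin 3 → ℝ) : E3 := (WithLp.equiv 2 (Fin 3 → ℝ)).symm v

/-- The cross product in `ℝ³`. -/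
def cross (a b : E3) : E3 :=
  toE3 ![a 1 * b 2 - a 2 * b 1, a 2 * b 0 - a 0 * b 2, a 0 * b 1 - a 1 * b 0]

def e1 : E3 := EuclideanSpace.single 0 1
def e2 : E3 := EuclideanSpace.single 1 1
def e3 : E3 := EuclideanSpace.single 2 1

/-- `(m, n, b)` solves the Serret–Frenet system with curvature `k(x) = c e^{-αx²/4}`,
torsion `τ(x) = βx/2` and initial conditions `(e₁, e₂, e₃)`. -/
def IsSF (α β c : ℝ) (m n b : ℝ → E3) : Prop :=
  (∀ x : ℝ, HasDerivAt m ((c * Real.exp (-α * x ^ 2 / 4)) • n x) x) ∧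
  (∀ x : ℝ, HasDerivAt n
    ((-(c * Real.exp (-α * x ^ 2 / 4))) • m x + (β * x / 2) • b x) x) ∧
  (∀ x : ℝ, HasDerivAt b ((-(β * x / 2)) • n x) x) ∧
  m 0 = e1 ∧ n 0 = e2 ∧ b 0 = e3

/-- A rotation of `ℝ³` preserving orientation: a linear isometry with determinant `1`. -/
def IsRotation (R : E3 ≃ₗᵢ[ℝ] E3) : Prop :=
  LinearMap.det (R.toLinearEquiv : E3 →ₗ[ℝ] E3) = 1

theorem E3.ext {a b : E3} (h0 : a 0 = b 0) (h1 : a 1 = b 1) (h2 : a 2 = b 2) : a = b := by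
  ext i
  fin_cases i
  exacts [h0, h1, h2]

theorem E3.inner_eq (a b : E3) : inner ℝ a b = a 0 * b 0 + a 1 * b 1 + a 2 * b 2 := by
  simp only [PiLp.inner_apply, RCLike.inner_apply, conj_trivial, Fin.sum_univ_three]
  ring

@[simp] theorem cross_zero (a b : E3) : cross a b 0 = a 1 * b 2 - a 2 * b 1 := rfl
@[simp] theorem cross_one (a b : E3) : cross a b 1 = a 2 * b 0 - a 0 * b 2 := rfl
@[simp] theorem cross_two (a b : E3) : cross a b 2 = a 0 * b 1 - a 1 * b 0 := rfl

theorem inner_cross_self (a b : E3) : inner ℝ (cross a b) (cross a b) =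
    (inner ℝ a a * inner ℝ b b - inner ℝ a b ^ 2 : ℝ) := by
  simp only [E3.inner_eq, cross_zero, cross_one, cross_two]
  ring

theorem HasDerivAt.coord {f : ℝ → E3} {f' : E3} {x : ℝ} (h : HasDerivAt f f' x) (i : Fin 3) :
    HasDerivAt (fun y => f y i) (f' i) x :=
  (EuclideanSpace.proj (𝕜 := ℝ) i).hasFDerivAt.comp_hasDerivAt x h

theorem hasDerivAt_of_coord {f : ℝ → E3} {f' : E3} {x : ℝ}
    (h : ∀ i, HasDerivAt (fun y => f y i) (f' i) x) : HasDerivAt f f' x :=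
  (PiLp.continuousLinearEquiv 2 ℝ (fun _ : Fin 3 => ℝ)).symm.hasFDerivAt.comp_hasDerivAt x
    (hasDerivAt_pi.2 h)

theorem HasDerivAt.cross {f g : ℝ → E3} {f' g' : E3} {x : ℝ} (hf : HasDerivAt f f' x)
    (hg : HasDerivAt g g' x) :
    HasDerivAt (fun y => cross (f y) (g y)) (cross (f x) g' + cross f' (g x)) x := by
  refine hasDerivAt_of_coord fun i => ?_
  fin_cases i
  · refine (((hf.coord 1).mul (hg.coord 2)).sub ((hf.coord 2).mul (hg.coord 1))).congr_deriv ?_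
    simp; ring
  · refine (((hf.coord 2).mul (hg.coord 0)).sub ((hf.coord 0).mul (hg.coord 2))).congr_deriv ?_
    simp; ring
  · refine (((hf.coord 0).mul (hg.coord 1)).sub ((hf.coord 1).mul (hg.coord 0))).congr_deriv ?_
    simp; ring

theorem HasDerivAt.linearIsometryEquiv_comp {f : ℝ → E3} {f' : E3} {x : ℝ}
    (R : E3 ≃ₗᵢ[ℝ] E3) (h : HasDerivAt f f' x) : HasDerivAt (fun y => R (f y)) (R f') x :=
  R.toContinuousLinearEquiv.hasFDerivAt.comp_hasDerivAt x h

/-- The matrix with rows `a`, `b`, `c`. -/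
def frameMatrix (a b c : E3) : Matrix (Fin 3) (Fin 3) ℝ :=
  !![a 0, a 1, a 2; b 0, b 1, b 2; c 0, c 1, c 2]

theorem det_frameMatrix (a b c : E3) : (frameMatrix a b c).det = inner ℝ (cross a b) c := by
  rw [frameMatrix, Matrix.det_fin_three, E3.inner_eq]
  simp
  ring

theorem linearMap_det_eq (L : E3 →ₗ[ℝ] E3) :
    LinearMap.det L = (frameMatrix (L e1) (L e2) (L e3)).det := by
  rw [← LinearMap.det_toMatrix (EuclideanSpace.basisFun (Fin 3) ℝ).toBasis,
    ← Matrix.det_transpose]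
  congr 1
  ext i j
  fin_cases i <;> fin_cases j <;>
    simp [LinearMap.toMatrix_apply, frameMatrix, e1, e2, e3]

/-- `(a, b, c)` is a positively oriented orthonormal frame. -/
structure IsFrame (a b c : E3) : Prop where
  mul_transpose : frameMatrix a b c * (frameMatrix a b c).transpose = 1
  det_eq_one : (frameMatrix a b c).det = 1

theorem frameMatrix_mul_transpose (a b c : E3) :
    frameMatrix a b c * (frameMatrix a b c).transpose =
      !![inner ℝ a a, inner ℝ a b, inner ℝ a c; inner ℝ b a, inner ℝ b b, inner ℝ b c;
        inner ℝ c a, inner ℝ c b, inner ℝ c c] := by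
  ext i j
  fin_cases i <;> fin_cases j <;>
    simp [frameMatrix, Matrix.mul_apply, Fin.sum_univ_three, E3.inner_eq,
      -inner_self_eq_norm_sq_to_K]

theorem IsFrame.inner_eq {a b c : E3} (h : IsFrame a b c) :
    inner ℝ a a = (1 : ℝ) ∧ inner ℝ b b = (1 : ℝ) ∧ inner ℝ c c = (1 : ℝ) ∧
      inner ℝ a b = (0 : ℝ) := by
  have h1 := h.mul_transpose
  rw [frameMatrix_mul_transpose] at h1
  refine ⟨?_, ?_, ?_, ?_⟩
  · simpa using congrFun₂ h1 0 0
  · simpa using congrFun₂ h1 1 1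
  · simpa using congrFun₂ h1 2 2
  · simpa using congrFun₂ h1 0 1

theorem IsFrame.cross_eq {a b c : E3} (h : IsFrame a b c) : cross a b = c := by
  obtain ⟨haa, hbb, hcc, hab⟩ := h.inner_eq
  have hd := h.det_eq_one
  rw [det_frameMatrix] at hd
  have hx : inner ℝ (cross a b) (cross a b) = (1 : ℝ) := by
    rw [inner_cross_self, haa, hbb, hab]
    norm_num
  refine sub_eq_zero.1 (inner_self_eq_zero (𝕜 := ℝ).1 ?_)
  rw [inner_sub_sub_self, hx, hcc, real_inner_comm (cross a b) c, hd]
  norm_num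

theorem isFrame_basis : IsFrame e1 e2 e3 := by
  have : frameMatrix e1 e2 e3 = 1 := by
    ext i j
    fin_cases i <;> fin_cases j <;> simp [frameMatrix, e1, e2, e3]
  constructor <;> simp [this]

theorem IsFrame.rotate {R : E3 ≃ₗᵢ[ℝ] E3} (hR : IsRotation R) :
    IsFrame (R e1) (R e2) (R e3) where
  mul_transpose := by
    have := isFrame_basis.mul_transpose
    rw [frameMatrix_mul_transpose] at this ⊢
    simpa only [R.inner_map_map] using this
  det_eq_one := by
    rw [← hR, linearMap_det_eq]
    rfl

theorem IsFrame.exists_rotation {a b c : E3} (h : IsFrame a b c) :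
    ∃ R : E3 ≃ₗᵢ[ℝ] E3, IsRotation R ∧ R e1 = a ∧ R e2 = b ∧ R e3 = c := by
  have h1 := h.mul_transpose
  rw [frameMatrix_mul_transpose] at h1
  have ho : Orthonormal ℝ ![a, b, c] := by
    rw [orthonormal_iff_ite]
    intro i j
    have := congrFun₂ h1 i j
    rw [Matrix.one_apply] at this
    rw [← this]
    fin_cases i <;> fin_cases j <;> rfl
  have hc : Fintype.card (Fin 3) = Module.finrank ℝ E3 := by simp
  let B := (basisOfOrthonormalOfCardEqFinrank ho hc).toOrthonormalBasis (by simpa using ho)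
  have hB : ∀ i, B.repr.symm (EuclideanSpace.single i 1) = ![a, b, c] i := by
    intro i
    rw [B.repr_symm_single]
    simp [B]
  refine ⟨B.repr.symm, ?_, hB 0, hB 1, hB 2⟩
  rw [IsRotation, linearMap_det_eq, ← h.det_eq_one]
  exact congrArg Matrix.det (congr (congrArg₂ frameMatrix (hB 0) (hB 1)) (hB 2))

/-- A Serret–Frenet flow preserves positively oriented orthonormal frames. -/
theorem IsFrame.of_serretFrenet {k τ : ℝ → ℝ} {m n b : ℝ → E3}
    (hm : ∀ x, HasDerivAt m (k x • n x) x)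
    (hn : ∀ x, HasDerivAt n (-(k x) • m x + τ x • b x) x)
    (hb : ∀ x, HasDerivAt b (-(τ x) • n x) x)
    (h0 : IsFrame (m 0) (n 0) (b 0)) (x : ℝ) : IsFrame (m x) (n x) (b x) := by
  have hgram (i j : Fin 3) : m x i * m x j + n x i * n x j + b x i * b x j =
      m 0 i * m 0 j + n 0 i * n 0 j + b 0 i * b 0 j := by
    have hd (y : ℝ) : HasDerivAt
        (fun y => m y i * m y j + n y i * n y j + b y i * b y j) 0 y := by
      refine (((((hm y).coord i).mul ((hm y).coord j)).add
        (((hn y).coord i).mul ((hn y).coord j))).add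
        (((hb y).coord i).mul ((hb y).coord j))).congr_deriv ?_
      simp only [PiLp.add_apply, PiLp.smul_apply, smul_eq_mul]
      ring
    exact is_const_of_deriv_eq_zero (fun y => (hd y).differentiableAt) (fun y => (hd y).deriv) x 0
  constructor
  · rw [mul_eq_one_comm, ← mul_eq_one_comm.1 h0.mul_transpose]
    ext i j
    have := hgram i j
    fin_cases i <;> fin_cases j <;>
      simpa [frameMatrix, Matrix.mul_apply, Fin.sum_univ_three] using this
  · rw [← h0.det_eq_one]
    have hd (y : ℝ) : HasDerivAt (fun y => (frameMatrix (m y) (n y) (b y)).det) 0 y := by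
      simp only [det_frameMatrix]
      refine (((hm y).cross (hn y)).inner ℝ (hb y)).congr_deriv ?_
      simp only [E3.inner_eq, cross_zero, cross_one, cross_two, PiLp.add_apply, PiLp.smul_apply,
        smul_eq_mul]
      ring
    exact is_const_of_deriv_eq_zero (fun y => (hd y).differentiableAt) (fun y => (hd y).deriv) x 0

theorem hasDerivAt_curvature (α c x : ℝ) :
    HasDerivAt (fun y => c * Real.exp (-α * y ^ 2 / 4))
      (-(α * x / 2) * (c * Real.exp (-α * x ^ 2 / 4))) x := by
  have h : HasDerivAt (fun y : ℝ => -α * y ^ 2 / 4) (-(α * x / 2)) x := by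
    refine (((hasDerivAt_pow 2 x).const_mul (-α)).div_const 4).congr_deriv ?_
    simp
    ring
  refine (h.exp.const_mul c).congr_deriv ?_
  ring

/-- The first vector of a Serret–Frenet frame with the expander curvature and torsion solves the
expander profile equation. -/
theorem expander_of_serretFrenet {α β c : ℝ} (hαβ : α ^ 2 + β ^ 2 = 1) (hc : 0 < c)
    {m n b : ℝ → E3}
    (hm : ∀ x, HasDerivAt m ((c * Real.exp (-α * x ^ 2 / 4)) • n x) x)
    (hn : ∀ x, HasDerivAt n
      (-(c * Real.exp (-α * x ^ 2 / 4)) • m x + (β * x / 2) • b x) x)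
    (hb : ∀ x, HasDerivAt b (-(β * x / 2) • n x) x)
    (h0 : IsFrame (m 0) (n 0) (b 0)) :
    ContDiff ℝ 2 m ∧ (∀ x, ‖m x‖ = 1) ∧
      (∀ x : ℝ,
        α • deriv (deriv m) x + (α * ‖deriv m x‖ ^ 2) • m x
          + β • deriv (fun y => cross (m y) (deriv m y)) x + (x / 2) • deriv m x = 0) ∧
      (∃ x y : ℝ, m x ≠ m y) := by
  have hF : ∀ x, IsFrame (m x) (n x) (b x) := IsFrame.of_serretFrenet hm hn hb h0
  have hk (x : ℝ) := hasDerivAt_curvature α c x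
  set k : ℝ → ℝ := fun x => c * Real.exp (-α * x ^ 2 / 4) with hkdef
  have hnorm (x : ℝ) : ‖n x‖ = 1 := by
    have := (hF x).inner_eq.2.1
    rw [real_inner_self_eq_norm_sq] at this
    exact (pow_eq_one_iff_of_nonneg (norm_nonneg _) two_ne_zero).1 this
  have hdm : deriv m = fun x => k x • n x := funext fun x => (hm x).deriv
  have hddm (x : ℝ) : HasDerivAt (fun y => k y • n y) _ x := (hk x).smul (hn x)
  have hkb (x : ℝ) : HasDerivAt (fun y => k y • b y) _ x := (hk x).smul (hb x)
  have hcross : (fun y => cross (m y) (deriv m y)) = fun y => k y • b y := by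
    funext y
    rw [← (hF y).cross_eq, hdm]
    apply E3.ext <;> simp <;> ring
  refine ⟨?_, ?_, ?_, ?_⟩
  · have hcn : Continuous n := continuous_iff_continuousAt.2 fun x => (hn x).continuousAt
    have hcm : Continuous m := continuous_iff_continuousAt.2 fun x => (hm x).continuousAt
    have hcb : Continuous b := continuous_iff_continuousAt.2 fun x => (hb x).continuousAt
    rw [show (2 : WithTop ℕ∞) = 1 + 1 from rfl, contDiff_succ_iff_deriv]
    refine ⟨fun x => (hm x).differentiableAt, by simp, ?_⟩
    rw [hdm, contDiff_one_iff_deriv]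
    refine ⟨fun x => (hddm x).differentiableAt, ?_⟩
    have : deriv (fun x => k x • n x) = _ := funext fun x => (hddm x).deriv
    rw [this]
    fun_prop
  · intro x
    have := (hF x).inner_eq.1
    rw [real_inner_self_eq_norm_sq] at this
    exact (pow_eq_one_iff_of_nonneg (norm_nonneg _) two_ne_zero).1 this
  · intro x
    rw [hcross, (hkb x).deriv, hdm, (hddm x).deriv]
    simp only [norm_smul, hnorm, mul_one, Real.norm_eq_abs, sq_abs]
    apply E3.ext <;>
    simp only [PiLp.add_apply, PiLp.smul_apply, smul_eq_mul, PiLp.zero_apply]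
    · linear_combination (-(x / 2) * k x * n x 0) * hαβ
    · linear_combination (-(x / 2) * k x * n x 1) * hαβ
    · linear_combination (-(x / 2) * k x * n x 2) * hαβ
  · by_contra! h
    have hconst : m = fun _ => m 0 := funext fun x => h x 0
    have : k 0 • n 0 = 0 := by
      rw [← (hm 0).deriv, hconst, deriv_const]
    have := congrArg norm this
    rw [norm_smul, hnorm] at this
    simp [hkdef, hc.ne'] at this

/-- On the unit sphere the expander profile equation can be solved for the second derivative. -/
theorem expander_second_derivative {α β t : ℝ} (hαβ : α ^ 2 + β ^ 2 = 1) {f g h : E3}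
    (hff : inner ℝ f f = (1 : ℝ)) (hfh : inner ℝ f h = -(inner ℝ g g : ℝ))
    (heq : α • h + (α * ‖g‖ ^ 2) • f + β • cross f h + (t / 2) • g = 0) :
    h = -(inner ℝ g g : ℝ) • f - (α * t / 2) • g + (β * t / 2) • cross f g := by
  rw [← real_inner_self_eq_norm_sq] at heq
  have h0 := congrArg (fun v : E3 => v 0) heq
  have h1 := congrArg (fun v : E3 => v 1) heq
  have h2 := congrArg (fun v : E3 => v 2) heq
  set q : ℝ := inner ℝ g g
  simp only [PiLp.add_apply, PiLp.smul_apply, smul_eq_mul, PiLp.zero_apply, cross_zero, cross_one,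
    cross_two] at h0 h1 h2
  simp only [E3.inner_eq] at hff hfh
  apply E3.ext <;>
  simp only [PiLp.add_apply, PiLp.sub_apply, PiLp.smul_apply, smul_eq_mul, cross_zero, cross_one,
    cross_two]
  · linear_combination α * h0 - β * (f 1 * h2 - f 2 * h1) - (h 0 + q * f 0) * hαβ
      + β ^ 2 * f 0 * hfh - β ^ 2 * h 0 * hff
  · linear_combination α * h1 - β * (f 2 * h0 - f 0 * h2) - (h 1 + q * f 1) * hαβ
      + β ^ 2 * f 1 * hfh - β ^ 2 * h 1 * hff
  · linear_combination α * h2 - β * (f 0 * h1 - f 1 * h0) - (h 2 + q * f 2) * hαβ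
      + β ^ 2 * f 2 * hfh - β ^ 2 * h 2 * hff

theorem isFrame_cross {a b : E3} (haa : inner ℝ a a = (1 : ℝ)) (hbb : inner ℝ b b = (1 : ℝ))
    (hab : inner ℝ a b = (0 : ℝ)) : IsFrame a b (cross a b) := by
  have hac : inner ℝ a (cross a b) = (0 : ℝ) := by
    simp only [E3.inner_eq, cross_zero, cross_one, cross_two]; ring
  have hbc : inner ℝ b (cross a b) = (0 : ℝ) := by
    simp only [E3.inner_eq, cross_zero, cross_one, cross_two]; ring
  have hcc : inner ℝ (cross a b) (cross a b) = (1 : ℝ) := by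
    rw [inner_cross_self, haa, hbb, hab]
    norm_num
  constructor
  · rw [frameMatrix_mul_transpose, real_inner_comm a b, real_inner_comm a (cross a b),
      real_inner_comm b (cross a b), haa, hbb, hab, hac, hbc, hcc, Matrix.one_fin_three]
  · rw [det_frameMatrix, hcc]

/-- Along a nonconstant expander profile the speed is a positive multiple of a Gaussian. -/
theorem expander_speed {α β : ℝ} {f g : ℝ → E3} (hf : ∀ x, HasDerivAt f (g x) x)
    (hg : ∀ x, HasDerivAt g (-(inner ℝ (g x) (g x) : ℝ) • f x - (α * x / 2) • g x
      + (β * x / 2) • cross (f x) (g x)) x)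
    (hfg : ∀ x, inner ℝ (f x) (g x) = (0 : ℝ)) (hne : ∃ x y : ℝ, f x ≠ f y) :
    ∃ c : ℝ, 0 < c ∧ ∀ x, inner ℝ (g x) (g x) = (c * Real.exp (-α * x ^ 2 / 4)) ^ 2 := by
  have hd (x : ℝ) : HasDerivAt
      (fun x => (inner ℝ (g x) (g x) : ℝ) * (1 * Real.exp (-(-α) * x ^ 2 / 4)) ^ 2) 0 x := by
    refine (((hg x).inner ℝ (hg x)).mul ((hasDerivAt_curvature (-α) 1 x).pow 2)).congr_deriv ?_
    have h := hfg x
    simp only [E3.inner_eq] at h ⊢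
    simp only [Pi.pow_apply, PiLp.add_apply, PiLp.sub_apply, PiLp.smul_apply, smul_eq_mul, cross_zero, cross_one,
      cross_two]
    linear_combination (-2 * (g x 0 * g x 0 + g x 1 * g x 1 + g x 2 * g x 2) *
      (1 * Real.exp (-(-α) * x ^ 2 / 4)) ^ 2) * h
  have hconst (x : ℝ) :=
    is_const_of_deriv_eq_zero (fun y => (hd y).differentiableAt) (fun y => (hd y).deriv) x 0
  have hspeed (x : ℝ) : inner ℝ (g x) (g x) =
      (‖g 0‖ * Real.exp (-α * x ^ 2 / 4)) ^ 2 := by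
    have he : Real.exp (-α * x ^ 2 / 4) * Real.exp (-(-α) * x ^ 2 / 4) = 1 := by
      rw [← Real.exp_add, ← Real.exp_zero]
      congr 1
      ring
    have h0 : Real.exp (-(-α) * 0 ^ 2 / 4) = 1 := by simp
    have h := hconst x
    simp only [h0, real_inner_self_eq_norm_sq (g 0)] at h
    rw [mul_pow, ← mul_one (inner ℝ (g x) (g x)), ← one_pow (M := ℝ) 2, ← he]
    linear_combination Real.exp (-α * x ^ 2 / 4) ^ 2 * h
  refine ⟨‖g 0‖, (norm_nonneg _).lt_of_ne fun h => ?_, hspeed⟩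
  obtain ⟨x, y, hxy⟩ := hne
  refine hxy (is_const_of_deriv_eq_zero (fun z => (hf z).differentiableAt) (fun z => ?_) x y)
  rw [(hf z).deriv, ← inner_self_eq_zero (𝕜 := ℝ), hspeed z, ← h]
  simp

/-- A curve on the sphere with Gaussian speed and the expander geodesic curvature carries a
Serret–Frenet frame. -/
theorem exists_serretFrenet {α β c : ℝ} (hc : 0 < c) {f g : ℝ → E3}
    (hf : ∀ x, HasDerivAt f (g x) x)
    (hg : ∀ x, HasDerivAt g (-(inner ℝ (g x) (g x) : ℝ) • f x - (α * x / 2) • g x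
      + (β * x / 2) • cross (f x) (g x)) x)
    (hff : ∀ x, inner ℝ (f x) (f x) = (1 : ℝ)) (hfg : ∀ x, inner ℝ (f x) (g x) = (0 : ℝ))
    (hspeed : ∀ x, inner ℝ (g x) (g x) = (c * Real.exp (-α * x ^ 2 / 4)) ^ 2) :
    ∃ n b : ℝ → E3, IsFrame (f 0) (n 0) (b 0) ∧
      (∀ x, HasDerivAt f ((c * Real.exp (-α * x ^ 2 / 4)) • n x) x) ∧
      (∀ x, HasDerivAt n
        (-(c * Real.exp (-α * x ^ 2 / 4)) • f x + (β * x / 2) • b x) x) ∧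
      (∀ x, HasDerivAt b (-(β * x / 2) • n x) x) := by
  have hk (x : ℝ) := hasDerivAt_curvature α c x
  have hkpos (x : ℝ) : 0 < c * Real.exp (-α * x ^ 2 / 4) := by positivity
  set k : ℝ → ℝ := fun x => c * Real.exp (-α * x ^ 2 / 4)
  have hkne (x : ℝ) : k x ≠ 0 := (hkpos x).ne'
  have hgn (x : ℝ) : k x • (k x)⁻¹ • g x = g x := smul_inv_smul₀ (hkne x) _
  have hfn (x : ℝ) : inner ℝ (f x) ((k x)⁻¹ • g x) = (0 : ℝ) := by
    rw [inner_smul_right, hfg, mul_zero]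
  have hf' (x : ℝ) : HasDerivAt f (k x • (k x)⁻¹ • g x) x := by rw [hgn]; exact hf x
  have hn (x : ℝ) : HasDerivAt (fun x => (k x)⁻¹ • g x)
      (-(k x) • f x + (β * x / 2) • cross (f x) ((k x)⁻¹ • g x)) x := by
    refine (((hk x).inv (hkne x)).smul (hg x)).congr_deriv ?_
    have hkx := hkne x
    rw [hspeed x]
    change _ = -(k x) • f x + (β * x / 2) • cross (f x) ((k x)⁻¹ • g x)
    apply E3.ext <;>
    simp only [PiLp.add_apply, PiLp.sub_apply, PiLp.smul_apply, smul_eq_mul, cross_zero, cross_one,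
      cross_two, Pi.inv_apply] <;>
    change _ * (-(k x) ^ 2 * _ - _ + _) + (- (-(α * x / 2) * k x) / (k x) ^ 2) * _ = _ <;>
    field_simp <;> ring
  refine ⟨fun x => (k x)⁻¹ • g x, fun x => cross (f x) ((k x)⁻¹ • g x), ?_, hf', hn, ?_⟩
  · refine isFrame_cross (hff 0) ?_ (hfn 0)
    rw [inner_smul_left, inner_smul_right, hspeed]
    change (k 0)⁻¹ * ((k 0)⁻¹ * (k 0) ^ 2) = 1
    have := hkne 0
    field_simp
  · intro x
    refine ((hf' x).cross (hn x)).congr_deriv ?_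
    have h1 := hff x
    have h2 := hfn x
    beta_reduce
    generalize (k x)⁻¹ • g x = n at h2 ⊢
    simp only [E3.inner_eq] at h1 h2
    apply E3.ext <;>
    simp only [PiLp.add_apply, PiLp.smul_apply, smul_eq_mul, cross_zero, cross_one, cross_two]
    · linear_combination (-(β * x / 2) * n 0) * h1 + (β * x / 2) * f x 0 * h2
    · linear_combination (-(β * x / 2) * n 1) * h1 + (β * x / 2) * f x 1 * h2
    · linear_combination (-(β * x / 2) * n 2) * h1 + (β * x / 2) * f x 2 * h2

/-- the nonconstant `S²`-valued solutions of the expander profile equation are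
exactly the rotations of the profiles `m_{c,α}`, `c > 0`. -/
theorem expander_profile_classification
    (α β : ℝ) (hα : α ∈ Set.Icc (0 : ℝ) 1) (hβ : β = Real.sqrt (1 - α ^ 2)) :
    ∀ f : ℝ → E3,
      (ContDiff ℝ 2 f ∧ (∀ x, ‖f x‖ = 1) ∧
        (∀ x : ℝ,
          α • deriv (deriv f) x + (α * ‖deriv f x‖ ^ 2) • f x
            + β • deriv (fun y => cross (f y) (deriv f y)) x + (x / 2) • deriv f x = 0) ∧
        (∃ x y : ℝ, f x ≠ f y))
      ↔ (∃ c : ℝ, 0 < c ∧ ∃ R : E3 ≃ₗᵢ[ℝ] E3, IsRotation R ∧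
          ∃ m n b : ℝ → E3, IsSF α β c m n b ∧ ∀ x, f x = R (m x)) := by
  have hαβ : α ^ 2 + β ^ 2 = 1 := by
    rw [hβ, Real.sq_sqrt (by nlinarith [hα.1, hα.2])]
    ring
  intro f
  constructor
  · rintro ⟨hC, hnorm, heq, hne⟩
    have hf (x : ℝ) : HasDerivAt f (deriv f x) x :=
      (hC.differentiable (by norm_num) x).hasDerivAt
    rw [show (2 : WithTop ℕ∞) = 1 + 1 from rfl, contDiff_succ_iff_deriv] at hC
    have hg (x : ℝ) : HasDerivAt (deriv f) (deriv (deriv f) x) x :=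
      (hC.2.2.differentiable (by norm_num) x).hasDerivAt
    have hff (x : ℝ) : inner ℝ (f x) (f x) = (1 : ℝ) := by
      rw [real_inner_self_eq_norm_sq, hnorm, one_pow]
    have hfg (x : ℝ) : inner ℝ (f x) (deriv f x) = (0 : ℝ) := by
      have h := (hf x).inner ℝ (hf x)
      simp only [hff, real_inner_comm (f x) (deriv f x)] at h
      linarith [h.unique (hasDerivAt_const x (1 : ℝ))]
    have hfh (x : ℝ) : inner ℝ (f x) (deriv (deriv f) x) =
        -(inner ℝ (deriv f x) (deriv f x) : ℝ) := by
      have h := (hf x).inner ℝ (hg x)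
      simp only [hfg] at h
      linarith [h.unique (hasDerivAt_const x (0 : ℝ))]
    have hcross (x : ℝ) : deriv (fun y => cross (f y) (deriv f y)) x =
        cross (f x) (deriv (deriv f) x) := by
      rw [((hf x).cross (hg x)).deriv]
      apply E3.ext <;> simp <;> ring
    have hsol (x : ℝ) := expander_second_derivative hαβ (hff x) (hfh x)
      (hcross x ▸ heq x)
    have hg' (x : ℝ) := (hg x).congr_deriv (hsol x)
    obtain ⟨c, hc, hspeed⟩ := expander_speed hf hg' hfg hne
    obtain ⟨n, b, hF, hm, hn, hb⟩ := exists_serretFrenet hc hf hg' hff hfg hspeed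
    obtain ⟨R, hR, h1, h2, h3⟩ := hF.exists_rotation
    refine ⟨c, hc, R, hR, fun x => R.symm (f x), fun x => R.symm (n x), fun x => R.symm (b x),
      ⟨fun x => ?_, fun x => ?_, fun x => ?_, ?_, ?_, ?_⟩, fun x => (R.apply_symm_apply _).symm⟩
    · simpa only [map_smul] using (hm x).linearIsometryEquiv_comp R.symm
    · simpa only [map_smul, map_add] using (hn x).linearIsometryEquiv_comp R.symm
    · simpa only [map_smul] using (hb x).linearIsometryEquiv_comp R.symm
    · exact R.symm_apply_eq.2 h1.symm
    · exact R.symm_apply_eq.2 h2.symm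
    · exact R.symm_apply_eq.2 h3.symm
  · rintro ⟨c, hc, R, hR, m, n, b, ⟨hm, hn, hb, h1, h2, h3⟩, hfm⟩
    obtain rfl : f = fun x => R (m x) := funext hfm
    refine expander_of_serretFrenet hαβ hc (n := fun x => R (n x)) (b := fun x => R (b x))
      (fun x => ?_) (fun x => ?_) (fun x => ?_) ?_
    · simpa only [map_smul] using (hm x).linearIsometryEquiv_comp R
    · simpa only [map_smul, map_add] using (hn x).linearIsometryEquiv_comp R
    · simpa only [map_smul] using (hb x).linearIsometryEquiv_comp R
    · simpa only [h1, h2, h3] using IsFrame.rotate hR
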